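/- Let A¹ and A² be finite nonempty types. For each player i ∈ {1,2} let Q_1^i, Q_2^i : A¹ × A² → ℝ satisfy Q_1^i(a¹,a²) ≥ Q_2^i(a¹,a²) for all (a¹,a²). Let (σ¹,σ²) be a Nash equilibrium of the stage game (Q_1^1, Q_1^2) and let (τ¹,τ²) be a Nash equilibrium of the stage game (Q_2^1, Q_2^2), and assume that either both (σ¹,σ²) and (τ¹,τ²) are global optimal points of their respective stage games, or both are saddle points of their respective stage games. Then for each player i ∈ {1,2}: val(Q_1^i, σ¹, σ²) ≥ val(Q_2^i, τ¹, τ²). -/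

import Mathlib

/-- A mixed strategy on a finite action set: nonnegative weights summing to one. -/
def IsMixed {A : Type*} [Fintype A] (σ : A → ℝ) : Prop :=
  (∀ a, 0 ≤ σ a) ∧ ∑ a, σ a = 1

/-- The stage-game value `val(Q, σ, τ) = ∑_{a¹} ∑_{a²} σ(a¹)·τ(a²)·Q(a¹,a²)`. -/
noncomputable def stageVal {A B : Type*} [Fintype A] [Fintype B]
    (Q : A × B → ℝ) (σ : A → ℝ) (τ : B → ℝ) : ℝ :=
  ∑ a, ∑ b, σ a * τ b * Q (a, b)

/-- `(σ, τ)` is a Nash equilibrium of the stage game `(Q1, Q2)`. -/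
def IsNashEq {A B : Type*} [Fintype A] [Fintype B]
    (Q1 Q2 : A × B → ℝ) (σ : A → ℝ) (τ : B → ℝ) : Prop :=
  IsMixed σ ∧ IsMixed τ ∧
    (∀ σ', IsMixed σ' → stageVal Q1 σ' τ ≤ stageVal Q1 σ τ) ∧
    (∀ τ', IsMixed τ' → stageVal Q2 σ τ' ≤ stageVal Q2 σ τ)

/-- `(σ, τ)` is a global optimal point of the stage game `(Q1, Q2)`. -/
def IsGlobalOpt {A B : Type*} [Fintype A] [Fintype B]
    (Q1 Q2 : A × B → ℝ) (σ : A → ℝ) (τ : B → ℝ) : Prop :=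
  IsMixed σ ∧ IsMixed τ ∧
    ∀ σ' τ', IsMixed σ' → IsMixed τ' →
      stageVal Q1 σ' τ' ≤ stageVal Q1 σ τ ∧ stageVal Q2 σ' τ' ≤ stageVal Q2 σ τ

/-- `(σ, τ)` is a saddle point of the stage game `(Q1, Q2)`: a Nash equilibrium at
which each player's value would only increase if the opponent deviated. -/
def IsSaddlePt {A B : Type*} [Fintype A] [Fintype B]
    (Q1 Q2 : A × B → ℝ) (σ : A → ℝ) (τ : B → ℝ) : Prop :=
  IsNashEq Q1 Q2 σ τ ∧
    (∀ τ', IsMixed τ' → stageVal Q1 σ τ ≤ stageVal Q1 σ τ') ∧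
    (∀ σ', IsMixed σ' → stageVal Q2 σ τ ≤ stageVal Q2 σ' τ)

theorem stageVal_mono_aux {A B : Type*} [Fintype A] [Fintype B]
    {P Q : A × B → ℝ} (h : ∀ a, P a ≥ Q a) {σ : A → ℝ} {τ : B → ℝ}
    (hσ : IsMixed σ) (hτ : IsMixed τ) : stageVal Q σ τ ≤ stageVal P σ τ :=
  Finset.sum_le_sum fun a _ => Finset.sum_le_sum fun b _ =>
    mul_le_mul_of_nonneg_left (h (a, b)) (mul_nonneg (hσ.1 a) (hτ.1 b))

/-- **Lemma 6 (monotonicity of stage values).**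
If the stage game `(Q1 1, Q1 2)` dominates `(Q2 1, Q2 2)` entrywise, `(σ¹,σ²)` is a
Nash equilibrium of the former and `(τ¹,τ²)` of the latter, and either both are
global optimal points or both are saddle points of their respective stage games,
then each player's stage value can only decrease:
`val(Q1 i, σ¹, σ²) ≥ val(Q2 i, τ¹, τ²)`. -/
theorem stage_value_monotone
    {A₁ A₂ : Type*} [Fintype A₁] [Fintype A₂] [Nonempty A₁] [Nonempty A₂]
    (Q1 Q2 : Fin 2 → A₁ × A₂ → ℝ)
    (hdom : ∀ i a, Q1 i a ≥ Q2 i a)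
    (σ1 : A₁ → ℝ) (σ2 : A₂ → ℝ) (τ1 : A₁ → ℝ) (τ2 : A₂ → ℝ)
    (hσ : IsNashEq (Q1 0) (Q1 1) σ1 σ2)
    (hτ : IsNashEq (Q2 0) (Q2 1) τ1 τ2)
    (hcase : (IsGlobalOpt (Q1 0) (Q1 1) σ1 σ2 ∧ IsGlobalOpt (Q2 0) (Q2 1) τ1 τ2) ∨
             (IsSaddlePt (Q1 0) (Q1 1) σ1 σ2 ∧ IsSaddlePt (Q2 0) (Q2 1) τ1 τ2)) :
    ∀ i : Fin 2, stageVal (Q1 i) σ1 σ2 ≥ stageVal (Q2 i) τ1 τ2 := by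
  obtain ⟨hs1, hs2, hn1, hn2⟩ := hσ
  obtain ⟨ht1, ht2, -, -⟩ := hτ
  rw [Fin.forall_fin_two]
  rcases hcase with ⟨h, -⟩ | ⟨-, h⟩
  · have h' := h.2.2 τ1 τ2 ht1 ht2
    exact ⟨(stageVal_mono_aux (hdom 0) ht1 ht2).trans h'.1,
      (stageVal_mono_aux (hdom 1) ht1 ht2).trans h'.2⟩
  · exact ⟨(h.2.1 σ2 hs2).trans ((stageVal_mono_aux (hdom 0) ht1 hs2).trans (hn1 τ1 ht1)),
      (h.2.2 σ1 hs1).trans ((stageVal_mono_aux (hdom 1) hs1 ht2).trans (hn2 τ2 ht2))⟩
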